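/- Let 2 < p < ∞. Then there exists C_p < ∞ such that for every n > 1, every z₀ in the closed unit disc, and every function a continuously differentiable on a neighbourhood of the closed unit disc, one has ‖ 𝒞( e^{−inR(·,z₀)} a ) ‖_{L^∞(Ω)} ≤ C_p n^{−1/5} ‖a‖_{W^{1,p}(Ω)}. -/

import Mathlib

open Complex MeasureTheory

/-- Wirtinger derivative `∂`. -/
noncomputable def wdz (g : ℂ → ℂ) (z : ℂ) : ℂ :=
  (fderiv ℝ g z 1 - Complex.I * fderiv ℝ g z Complex.I) / 2

/-- Wirtinger derivative `∂̄`. -/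
noncomputable def wdzbar (g : ℂ → ℂ) (z : ℂ) : ℂ :=
  (fderiv ℝ g z 1 + Complex.I * fderiv ℝ g z Complex.I) / 2

/-- The `W^{1,l}(Ω)` norm `‖g‖_{L^l(Ω)} + ‖∂g‖_{L^l(Ω)} + ‖∂̄g‖_{L^l(Ω)}`,
where `Ω` is the open unit disc. -/
noncomputable def W1Norm (g : ℂ → ℂ) (l : ℝ) : ℝ :=
  (eLpNorm g (ENNReal.ofReal l) (volume.restrict (Metric.ball (0 : ℂ) 1))).toReal +
  (eLpNorm (wdz g) (ENNReal.ofReal l) (volume.restrict (Metric.ball (0 : ℂ) 1))).toReal +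
  (eLpNorm (wdzbar g) (ENNReal.ofReal l) (volume.restrict (Metric.ball (0 : ℂ) 1))).toReal

/-- The quadratic oscillation `e^{-iλt²}`. -/
noncomputable def chirp (l t : ℝ) : ℂ := Complex.exp (-Complex.I * (l * t ^ 2 : ℝ))

lemma norm_chirp (l t : ℝ) : ‖chirp l t‖ = 1 := by
  rw [chirp, neg_mul, mul_comm, ← neg_mul, ← Complex.ofReal_neg, Complex.norm_exp_ofReal_mul_I]

lemma continuous_chirp (l : ℝ) : Continuous (chirp l) := by
  unfold chirp; fun_prop

lemma hasDerivAt_chirp (l t : ℝ) :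
    HasDerivAt (chirp l) (-Complex.I * (2 * l * t) * chirp l t) t := by
  have h1 : HasDerivAt (fun s : ℝ => l * s ^ 2) (l * (2 * t)) t := by
    simpa using (hasDerivAt_pow 2 t).const_mul l
  have h2 : HasDerivAt (chirp l) _ t := ((h1.ofReal_comp).const_mul (-Complex.I)).cexp
  refine h2.congr_deriv ?_
  simp only [chirp]; push_cast; ring

lemma norm_integral_chirp_tail_le {l r b : ℝ} (hl : 0 < l) (hr : 0 < r) (hb : r ≤ b) :
    ‖∫ t in r..b, chirp l t‖ ≤ 1 / (l * r) := by
  have hpos : ∀ t ∈ Set.uIcc r b, 0 < t := fun t ht => by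
    rw [Set.uIcc_of_le hb] at ht; exact hr.trans_le ht.1
  set F : ℝ → ℂ := fun t => Complex.I * chirp l t * ((2 * l * t : ℝ) : ℂ)⁻¹ with hF
  set E : ℝ → ℂ := fun t => Complex.I * chirp l t * ((2 * l * t ^ 2 : ℝ) : ℂ)⁻¹ with hE
  have hder : ∀ t ∈ Set.uIcc r b, HasDerivAt F (chirp l t - E t) t := by
    intro t ht
    have ht0 : (t : ℂ) ≠ 0 := by exact_mod_cast (hpos t ht).ne'
    have hl0 : (l : ℂ) ≠ 0 := by exact_mod_cast hl.ne'
    have h1 : HasDerivAt (fun s : ℝ => ((2 * l * s : ℝ) : ℂ)) ((2 * l : ℝ) : ℂ) t := by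
      simpa using ((hasDerivAt_id t).const_mul (2 * l)).ofReal_comp
    have h3 : ((2 * l * t : ℝ) : ℂ) ≠ 0 := by
      have := hpos t ht
      exact_mod_cast (by positivity : 2 * l * t ≠ 0)
    have h2 : HasDerivAt F _ t := ((hasDerivAt_chirp l t).const_mul Complex.I).mul
      (h1.fun_inv h3)
    refine h2.congr_deriv ?_
    simp only [hE]; push_cast; field_simp
    linear_combination (-2 * t ^ 2 * l * chirp l t : ℂ) * Complex.I_sq
  have hcE : ContinuousOn E (Set.uIcc r b) := by
    refine ContinuousOn.mul (by have := continuous_chirp l; fun_prop) (ContinuousOn.inv₀ (by fun_prop) ?_)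
    intro t ht
    have := hpos t ht
    exact_mod_cast (by positivity : 2 * l * t ^ 2 ≠ 0)
  have hiE : IntervalIntegrable E volume r b := hcE.intervalIntegrable
  have hic : IntervalIntegrable (chirp l) volume r b := (continuous_chirp l).intervalIntegrable _ _
  have hftc := intervalIntegral.integral_eq_sub_of_hasDerivAt hder (hic.sub hiE)
  rw [intervalIntegral.integral_sub hic hiE] at hftc
  have hkey : ∫ t in r..b, chirp l t = F b - F r + ∫ t in r..b, E t := by rw [← hftc]; ring
  have hnF : ∀ t, 0 < t → ‖F t‖ = 1 / (2 * l * t) := fun t ht => by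
    rw [hF, norm_mul, norm_mul, norm_inv, norm_chirp, Complex.norm_I, Complex.norm_real,
      Real.norm_of_nonneg (by positivity), one_mul, one_mul, one_div]
  have hnE : ‖∫ t in r..b, E t‖ ≤ 1 / (2 * l) * (1 / r - 1 / b) := by
    have hG : ∀ t ∈ Set.uIcc r b, HasDerivAt (fun s : ℝ => -(1 / (2 * l)) * s⁻¹)
        (1 / (2 * l * t ^ 2)) t := by
      intro t ht
      have := hpos t ht
      refine ((hasDerivAt_inv this.ne').const_mul (-(1 / (2 * l)))).congr_deriv ?_
      field_simp
    have hci : IntervalIntegrable (fun t : ℝ => 1 / (2 * l * t ^ 2)) volume r b := by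
      refine ContinuousOn.intervalIntegrable (ContinuousOn.div (by fun_prop) (by fun_prop) ?_)
      intro t ht
      have := hpos t ht
      positivity
    have h1 := intervalIntegral.integral_eq_sub_of_hasDerivAt hG hci
    refine (intervalIntegral.norm_integral_le_of_norm_le hb
      (Filter.Eventually.of_forall fun t ht => ?_) hci).trans (le_of_eq ?_)
    · have : 0 < t := hr.trans ht.1
      rw [hE, norm_mul, norm_mul, norm_inv, norm_chirp, Complex.norm_I, Complex.norm_real,
        Real.norm_of_nonneg (by positivity), one_mul, one_mul, one_div]
    · rw [h1]; ring
  have hb0 : 0 < b := hr.trans_le hb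
  calc ‖∫ t in r..b, chirp l t‖ ≤ ‖F b‖ + ‖F r‖ + 1 / (2 * l) * (1 / r - 1 / b) := by
        rw [hkey]
        exact (norm_add_le _ _).trans (add_le_add (norm_sub_le _ _) hnE)
    _ = 1 / (l * r) := by
        rw [hnF b hb0, hnF r hr]; field_simp; ring

lemma norm_integral_chirp_zero_le {l b : ℝ} (hl : 0 < l) (hb : 0 ≤ b) :
    ‖∫ t in (0 : ℝ)..b, chirp l t‖ ≤ 2 / √l := by
  have hs : 0 < √l := Real.sqrt_pos.2 hl
  have htriv : ∀ c : ℝ, 0 ≤ c → ‖∫ t in (0 : ℝ)..c, chirp l t‖ ≤ c := fun c hc => by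
    simpa [abs_of_nonneg hc] using intervalIntegral.norm_integral_le_of_norm_le_const
      (a := 0) (b := c) (f := chirp l) (C := 1) fun x _ => (norm_chirp l x).le
  have hr : 0 < 1 / √l := by positivity
  have e2 : 2 / √l = 1 / √l + 1 / √l := by ring
  rcases le_total b (1 / √l) with h | h
  · exact (htriv b hb).trans (by rw [e2]; linarith)
  · rw [← intervalIntegral.integral_add_adjacent_intervals
      ((continuous_chirp l).intervalIntegrable 0 (1 / √l))
      ((continuous_chirp l).intervalIntegrable (1 / √l) b), e2]
    refine (norm_add_le _ _).trans (add_le_add (htriv _ hr.le) ?_)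
    refine (norm_integral_chirp_tail_le hl hr h).trans (le_of_eq ?_)
    nth_rewrite 1 [← Real.mul_self_sqrt hl.le]
    field_simp

lemma norm_integral_chirp_le {l : ℝ} (hl : 0 < l) (a b : ℝ) :
    ‖∫ t in a..b, chirp l t‖ ≤ 4 / √l := by
  have h0 : ∀ c : ℝ, ‖∫ t in (0 : ℝ)..c, chirp l t‖ ≤ 2 / √l := fun c => by
    rcases le_total 0 c with h | h
    · exact norm_integral_chirp_zero_le hl h
    · have : ∫ t in (0 : ℝ)..c, chirp l t = -∫ t in (0 : ℝ)..(-c), chirp l t := by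
        have h1 := intervalIntegral.integral_comp_neg (a := 0) (b := -c) (chirp l)
        rw [neg_neg, neg_zero] at h1
        rw [intervalIntegral.integral_symm, ← h1]
        simp [chirp]
      rw [this, norm_neg]
      exact norm_integral_chirp_zero_le hl (by linarith)
  have hi : ∀ u v, IntervalIntegrable (chirp l) volume u v :=
    fun u v => (continuous_chirp l).intervalIntegrable u v
  rw [← intervalIntegral.integral_interval_sub_left (hi 0 b) (hi 0 a)]
  refine (norm_sub_le _ _).trans ((add_le_add (h0 b) (h0 a)).trans (le_of_eq ?_))
  ring

/-- A van der Corput estimate for a quadratic phase with `C¹` amplitude. -/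
lemma norm_integral_chirp_mul_le {l c a b : ℝ} (hl : 0 < l) (hab : a ≤ b) {g g' : ℝ → ℂ}
    (hg : ∀ t ∈ Set.Icc a b, HasDerivAt g (g' t) t) (hg' : ContinuousOn g' (Set.Icc a b)) :
    ‖∫ t in a..b, chirp l (t - c) * g t‖ ≤ 4 / √l * (‖g b‖ + ∫ t in a..b, ‖g' t‖) := by
  have hc : Continuous fun t => chirp l (t - c) := (continuous_chirp l).comp (by fun_prop)
  set E : ℝ → ℂ := fun x => ∫ t in a..x, chirp l (t - c) with hE
  have hEb : ∀ x, ‖E x‖ ≤ 4 / √l := fun x => by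
    simp only [hE]
    rw [intervalIntegral.integral_comp_sub_right (chirp l)]
    exact norm_integral_chirp_le hl _ _
  have hEd : ∀ x, HasDerivAt E (chirp l (x - c)) x := fun x =>
    intervalIntegral.integral_hasDerivAt_right (hc.intervalIntegrable _ _)
      hc.aestronglyMeasurable.stronglyMeasurableAtFilter hc.continuousAt
  have hgi : IntervalIntegrable g' volume a b := by
    apply ContinuousOn.intervalIntegrable; rwa [Set.uIcc_of_le hab]
  have hparts := intervalIntegral.integral_mul_deriv_eq_deriv_mul (u := g) (v := E)
    (u' := g') (v' := fun t => chirp l (t - c)) (a := a) (b := b)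
    (by rw [Set.uIcc_of_le hab]; exact hg) (fun x _ => hEd x) hgi (hc.intervalIntegrable _ _)
  have hEa : E a = 0 := by simp [hE]
  have e1 : ∫ t in a..b, chirp l (t - c) * g t = g b * E b - ∫ t in a..b, g' t * E t := by
    rw [hEa, mul_zero, sub_zero] at hparts
    rw [← hparts]; simp only [mul_comm]
  have h2 : ‖∫ t in a..b, g' t * E t‖ ≤ 4 / √l * ∫ t in a..b, ‖g' t‖ := by
    rw [← intervalIntegral.integral_const_mul]
    refine intervalIntegral.norm_integral_le_of_norm_le hab
      (Filter.Eventually.of_forall fun t _ => ?_) (hgi.norm.const_mul _)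
    rw [norm_mul, mul_comm]
    exact mul_le_mul_of_nonneg_right (hEb t) (norm_nonneg _)
  rw [e1, mul_add]
  refine (norm_sub_le _ _).trans (add_le_add ?_ h2)
  rw [norm_mul, mul_comm]
  exact mul_le_mul_of_nonneg_right (hEb b) (norm_nonneg _)
/-- The size `|∂g| + |∂̄g|` of the gradient. -/
noncomputable def gradSize (g : ℂ → ℂ) (z : ℂ) : ℝ := ‖wdz g z‖ + ‖wdzbar g z‖

lemma gradSize_nonneg (g : ℂ → ℂ) (z : ℂ) : 0 ≤ gradSize g z := by unfold gradSize; positivity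

lemma measurable_wdz (g : ℂ → ℂ) : Measurable (wdz g) := by
  unfold wdz
  exact ((measurable_fderiv_apply_const ℝ g 1).sub
    ((measurable_fderiv_apply_const ℝ g Complex.I).const_mul _)).div_const _

lemma measurable_wdzbar (g : ℂ → ℂ) : Measurable (wdzbar g) := by
  unfold wdzbar
  exact ((measurable_fderiv_apply_const ℝ g 1).add
    ((measurable_fderiv_apply_const ℝ g Complex.I).const_mul _)).div_const _

lemma measurable_gradSize (g : ℂ → ℂ) : Measurable (gradSize g) :=
  (measurable_wdz g).norm.add (measurable_wdzbar g).norm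

lemma norm_fderiv_apply_le (g : ℂ → ℂ) (z v : ℂ) :
    ‖fderiv ℝ g z v‖ ≤ ‖v‖ * gradSize g z := by
  have hv : v = v.re • (1 : ℂ) + v.im • Complex.I := by
    simp [Complex.re_add_im]
  have h : fderiv ℝ g z v = v * wdz g z + (starRingEnd ℂ) v * wdzbar g z := by
    conv_lhs => rw [hv, map_add, map_smul, map_smul]
    simp only [wdz, wdzbar, Complex.real_smul]
    have h1 : (starRingEnd ℂ) v = v.re - v.im * Complex.I := by
      apply Complex.ext <;> simp
    have h2 : v = v.re + v.im * Complex.I := (Complex.re_add_im v).symm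
    rw [h1]
    generalize fderiv ℝ g z 1 = A
    generalize fderiv ℝ g z Complex.I = B
    linear_combination (v.im * B : ℂ) * Complex.I_sq - (A - Complex.I * B) / 2 * h2
  rw [h, gradSize, mul_add]
  refine (norm_add_le _ _).trans (le_of_eq ?_)
  rw [norm_mul, norm_mul, RCLike.norm_conj]

/-- Fundamental theorem of calculus along a segment of the disc. -/
lemma enorm_le_add_lintegral_gradSize {a : ℂ → ℂ} {U : Set ℂ} (hU : IsOpen U)
    (hUb : Metric.closedBall (0 : ℂ) 1 ⊆ U) (ha : ContDiffOn ℝ 1 a U) {w ζ : ℂ}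
    (hw : w ∈ Metric.closedBall (0 : ℂ) 1) (hζ : ζ ∈ Metric.closedBall (0 : ℂ) 1) :
    ‖a w‖ₑ ≤ ‖a ζ‖ₑ +
      ∫⁻ t in Set.Ioc (0 : ℝ) 1, 2 * ENNReal.ofReal (gradSize a (w + t • (ζ - w))) := by
  have hseg : ∀ t ∈ Set.uIcc (0 : ℝ) 1, w + t • (ζ - w) ∈ U := fun t ht => by
    rw [Set.uIcc_of_le zero_le_one] at ht
    exact hUb ((convex_closedBall (0 : ℂ) 1).add_smul_sub_mem hw hζ ht)
  have hcont := ha.continuousOn_fderiv_of_isOpen hU le_rfl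
  have hd : ∀ t ∈ Set.uIcc (0 : ℝ) 1, HasDerivAt (fun s : ℝ => a (w + s • (ζ - w)))
      (fderiv ℝ a (w + t • (ζ - w)) (ζ - w)) t := by
    intro t ht
    have h1 : HasDerivAt (fun s : ℝ => w + s • (ζ - w)) (ζ - w) t := by
      simpa using ((hasDerivAt_id t).smul_const (ζ - w)).const_add w
    exact ((ha.differentiableOn (by norm_num)).differentiableAt
      (hU.mem_nhds (hseg t ht))).hasFDerivAt.comp_hasDerivAt t h1
  have hci : IntervalIntegrable (fun t : ℝ => fderiv ℝ a (w + t • (ζ - w)) (ζ - w)) volume 0 1 := by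
    apply ContinuousOn.intervalIntegrable
    exact (hcont.comp (f := fun t : ℝ => w + t • (ζ - w)) (by fun_prop) hseg).clm_apply
      continuousOn_const
  have hftc := intervalIntegral.integral_eq_sub_of_hasDerivAt hd hci
  simp only [one_smul, zero_smul, add_zero, add_sub_cancel] at hftc
  have e : a w = a ζ - ∫ t in (0 : ℝ)..1, fderiv ℝ a (w + t • (ζ - w)) (ζ - w) := by
    rw [hftc]; ring
  rw [e]
  refine enorm_sub_le.trans (add_le_add le_rfl ?_)
  rw [intervalIntegral.integral_of_le zero_le_one]
  refine (enorm_integral_le_lintegral_enorm _).trans (lintegral_mono fun t => ?_)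
  rw [← ofReal_norm, ← ENNReal.ofReal_ofNat 2, ← ENNReal.ofReal_mul zero_le_two]
  refine ENNReal.ofReal_le_ofReal ((norm_fderiv_apply_le a _ _).trans
    (mul_le_mul_of_nonneg_right ?_ (gradSize_nonneg _ _)))
  rw [mem_closedBall_zero_iff] at hw hζ
  linarith [norm_sub_le ζ w]

lemma lintegral_comp_add_smul_sub {f : ℂ → ENNReal} (hf : Measurable f) (w : ℂ) {t : ℝ}
    (ht : 0 < t) :
    ∫⁻ ζ, f (w + t • (ζ - w)) = ENNReal.ofReal (t ^ 2)⁻¹ * ∫⁻ z, f z := by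
  have hm : Measurable fun z => f (z + (w - t • w)) := hf.comp (by fun_prop)
  have h1 := lintegral_map (μ := volume) hm (measurable_const_smul t : Measurable fun z : ℂ => t • z)
  rw [Measure.map_addHaar_smul _ ht.ne', lintegral_smul_measure,
    lintegral_add_right_eq_self f, Complex.finrank_real_complex, abs_of_pos (by positivity)] at h1
  rw [smul_eq_mul] at h1
  rw [h1]
  refine lintegral_congr fun ζ => ?_
  congr 1
  rw [smul_sub]; ring

lemma setLIntegral_ball_le_eLpNorm {E : Type*} [NormedAddCommGroup E] {p : ℝ} (hp : 1 ≤ p)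
    {f : ℂ → E} {c : ℂ} {t : ℝ}
    (hf : AEStronglyMeasurable f (volume.restrict (Metric.ball c t))) :
    ∫⁻ z in Metric.ball c t, ‖f z‖ₑ ≤
      eLpNorm f (ENNReal.ofReal p) (volume.restrict (Metric.ball c t)) *
        (ENNReal.ofReal t ^ 2 * NNReal.pi) ^ (1 - 1 / p) := by
  have h := eLpNorm_le_eLpNorm_mul_rpow_measure_univ (p := 1) (q := ENNReal.ofReal p)
    (by simpa using hp) hf
  rwa [eLpNorm_one_eq_lintegral_enorm, Measure.restrict_apply_univ, Complex.volume_ball,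
    ENNReal.toReal_ofReal (by linarith), ENNReal.toReal_one, div_one] at h

lemma setLIntegral_comp_add_smul_sub_le {p : ℝ} (hp : 1 ≤ p) {f : ℂ → ℝ} (hf : Measurable f)
    (hf0 : ∀ z, 0 ≤ f z) {w : ℂ} (hw : w ∈ Metric.closedBall (0 : ℂ) 1) {t : ℝ}
    (ht : t ∈ Set.Ioc (0 : ℝ) 1) :
    ∫⁻ ζ in Metric.ball (0 : ℂ) 1, ENNReal.ofReal (f (w + t • (ζ - w))) ≤
      ENNReal.ofReal (t ^ (-(2 / p))) * ((NNReal.pi : ENNReal) ^ (1 - 1 / p) *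
        eLpNorm f (ENNReal.ofReal p) (volume.restrict (Metric.ball (0 : ℂ) 1))) := by
  have ht0 := ht.1
  rw [mem_closedBall_zero_iff] at hw
  set c : ℂ := (1 - t) • w with hc
  have hsub : Metric.ball c t ⊆ Metric.ball (0 : ℂ) 1 := by
    apply Metric.ball_subset_ball'
    rw [dist_zero_right, hc, norm_smul, Real.norm_of_nonneg (by linarith [ht.2])]
    nlinarith [ht.2]
  have h1 : ∫⁻ ζ in Metric.ball (0 : ℂ) 1, ENNReal.ofReal (f (w + t • (ζ - w))) ≤
      ∫⁻ ζ, (Metric.ball c t).indicator (fun z => ENNReal.ofReal (f z)) (w + t • (ζ - w)) := by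
    rw [← lintegral_indicator measurableSet_ball]
    refine lintegral_mono fun ζ => ?_
    by_cases hζ : ζ ∈ Metric.ball (0 : ℂ) 1
    · rw [Set.indicator_of_mem hζ, Set.indicator_of_mem]
      rw [mem_ball_zero_iff] at hζ
      rw [mem_ball_iff_norm]
      have : w + t • (ζ - w) - c = t • ζ := by rw [hc, smul_sub, sub_smul, one_smul]; ring
      rw [this, norm_smul, Real.norm_of_nonneg ht0.le]
      nlinarith
    · rw [Set.indicator_of_notMem hζ]; exact zero_le
  refine h1.trans ?_
  rw [lintegral_comp_add_smul_sub (hf.ennreal_ofReal.indicator measurableSet_ball) w ht0,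
    lintegral_indicator measurableSet_ball]
  have h2 := (setLIntegral_ball_le_eLpNorm hp (c := c) (t := t) hf.aestronglyMeasurable).trans (mul_le_mul_left
    (eLpNorm_mono_measure f (Measure.restrict_mono hsub le_rfl)) _)
  simp only [← ofReal_norm, Real.norm_of_nonneg (hf0 _)] at h2
  refine (mul_le_mul_right h2 _).trans (le_of_eq ?_)
  have hθ : 0 ≤ 1 - 1 / p := by rw [sub_nonneg, div_le_one (by linarith)]; exact hp
  rw [ENNReal.mul_rpow_of_nonneg _ _ hθ, ← ENNReal.ofReal_pow ht0.le,
    ENNReal.ofReal_rpow_of_nonneg (by positivity) hθ]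
  have e : t ^ (-(2 / p)) = (t ^ 2)⁻¹ * (t ^ 2) ^ (1 - 1 / p) := by
    rw [← Real.rpow_natCast, ← Real.rpow_mul ht0.le, ← Real.rpow_neg ht0.le, ← Real.rpow_add ht0]
    congr 1; push_cast; ring
  rw [e, ENNReal.ofReal_mul (by positivity)]
  ring

/-- The `[0, ∞]`-valued version of `W1Norm`. -/
noncomputable def eW1Norm (g : ℂ → ℂ) (p : ℝ) : ENNReal :=
  eLpNorm g (ENNReal.ofReal p) (volume.restrict (Metric.ball (0 : ℂ) 1)) +
  eLpNorm (wdz g) (ENNReal.ofReal p) (volume.restrict (Metric.ball (0 : ℂ) 1)) +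
  eLpNorm (wdzbar g) (ENNReal.ofReal p) (volume.restrict (Metric.ball (0 : ℂ) 1))

lemma eLpNorm_gradSize_le {p : ℝ} (hp : 1 ≤ p) (g : ℂ → ℂ) :
    eLpNorm (gradSize g) (ENNReal.ofReal p) (volume.restrict (Metric.ball (0 : ℂ) 1)) ≤
      eW1Norm g p := by
  have h := eLpNorm_add_le (p := ENNReal.ofReal p)
    (μ := volume.restrict (Metric.ball (0 : ℂ) 1))
    (measurable_wdz g).norm.aestronglyMeasurable (measurable_wdzbar g).norm.aestronglyMeasurable
    (by simpa using hp)
  rw [eLpNorm_norm, eLpNorm_norm] at h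
  refine h.trans ?_
  rw [eW1Norm, add_assoc]
  exact le_add_self

lemma ofReal_W1Norm {a : ℂ → ℂ} {U : Set ℂ} (hU : IsOpen U)
    (hUb : Metric.closedBall (0 : ℂ) 1 ⊆ U) (ha : ContDiffOn ℝ 1 a U) (p : ℝ) :
    ENNReal.ofReal (W1Norm a p) = eW1Norm a p := by
  have key : ∀ f : ℂ → ℂ, ContinuousOn f U →
      eLpNorm f (ENNReal.ofReal p) (volume.restrict (Metric.ball (0 : ℂ) 1)) ≠ ⊤ := by
    intro f hf
    obtain ⟨M, hM⟩ := (isCompact_closedBall (0 : ℂ) 1).exists_bound_of_continuousOn (hf.mono hUb)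
    refine ((eLpNorm_le_of_ae_bound (C := M) ?_).trans_lt ?_).ne
    · exact (ae_restrict_iff' measurableSet_ball).2 (Filter.Eventually.of_forall fun x hx =>
        hM x (Metric.ball_subset_closedBall hx))
    · rw [Measure.restrict_apply_univ, Complex.volume_ball]
      refine ENNReal.mul_lt_top (ENNReal.rpow_lt_top_of_nonneg (by positivity) ?_)
        ENNReal.ofReal_lt_top
      simp
  have hcont := ha.continuousOn_fderiv_of_isOpen hU le_rfl
  have h1 : ContinuousOn (fun z => fderiv ℝ a z 1) U := hcont.clm_apply continuousOn_const
  have h2 : ContinuousOn (fun z => fderiv ℝ a z Complex.I) U := hcont.clm_apply continuousOn_const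
  have k0 := key a ha.continuousOn
  have k1 := key (wdz a) (by unfold wdz; fun_prop)
  have k2 := key (wdzbar a) (by unfold wdzbar; fun_prop)
  rw [W1Norm, eW1Norm, ENNReal.ofReal_add (by positivity) (by positivity),
    ENNReal.ofReal_add (by positivity) (by positivity), ENNReal.ofReal_toReal k0,
    ENNReal.ofReal_toReal k1, ENNReal.ofReal_toReal k2]

/-- Morrey's inequality on the disc: `W^{1,p}` controls the supremum for `p > 2`. -/
lemma exists_enorm_le_mul_eW1Norm {p : ℝ} (hp : 2 < p) :
    ∃ C : ENNReal, C ≠ ⊤ ∧ ∀ (a : ℂ → ℂ) (U : Set ℂ), IsOpen U →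
      Metric.closedBall (0 : ℂ) 1 ⊆ U → ContDiffOn ℝ 1 a U →
      ∀ w ∈ Metric.closedBall (0 : ℂ) 1, ‖a w‖ₑ ≤ C * eW1Norm a p := by
  have hp1 : 1 ≤ p := by linarith
  set T : ENNReal := ∫⁻ t in Set.Ioc (0 : ℝ) 1, ENNReal.ofReal (t ^ (-(2 / p))) with hT
  have hTtop : T ≠ ⊤ := by
    have hi : IntervalIntegrable (fun t : ℝ => t ^ (-(2 / p))) volume 0 1 := by
      apply intervalIntegral.intervalIntegrable_rpow'
      rw [neg_lt_neg_iff, div_lt_one (by linarith)]; exact hp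
    rw [intervalIntegrable_iff_integrableOn_Ioc_of_le zero_le_one] at hi
    refine ((lintegral_mono fun t => ?_).trans_lt hi.2).ne
    rw [← ofReal_norm]
    exact ENNReal.ofReal_le_ofReal (le_abs_self _)
  have hθ : 0 ≤ 1 - 1 / p := by rw [sub_nonneg, div_le_one (by linarith)]; exact hp1
  set Q : ENNReal := (NNReal.pi : ENNReal) ^ (1 - 1 / p) with hQ
  have hQtop : Q ≠ ⊤ := ENNReal.rpow_ne_top_of_nonneg hθ ENNReal.coe_ne_top
  have hpi0 : (NNReal.pi : ENNReal) ≠ 0 := by exact_mod_cast NNReal.pi_ne_zero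
  refine ⟨(NNReal.pi : ENNReal)⁻¹ * (Q + 2 * (T * Q)), by finiteness, ?_⟩
  intro a U hU hUb ha w hw
  set Ω := Metric.ball (0 : ℂ) 1 with hΩ
  set G : ℂ → ℝ := gradSize a with hG
  have hGm : Measurable G := measurable_gradSize a
  have hm2 : Measurable fun q : ℂ × ℝ =>
      2 * ENNReal.ofReal (G (w + q.2 • (q.1 - w))) :=
    ((hGm.comp (by fun_prop)).ennreal_ofReal).const_mul 2
  have hmΩ : AEStronglyMeasurable a (volume.restrict Ω) :=
    ContinuousOn.aestronglyMeasurable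
      (ha.continuousOn.mono (Metric.ball_subset_closedBall.trans hUb)) measurableSet_ball
  have hvol : volume Ω = NNReal.pi := by rw [hΩ, Complex.volume_ball]; simp
  have h1 : (NNReal.pi : ENNReal) * ‖a w‖ₑ ≤ (∫⁻ ζ in Ω, ‖a ζ‖ₑ) +
      ∫⁻ t in Set.Ioc (0 : ℝ) 1, ∫⁻ ζ in Ω, 2 * ENNReal.ofReal (G (w + t • (ζ - w))) := by
    rw [← lintegral_lintegral_swap (f := fun ζ t => 2 * ENNReal.ofReal (G (w + t • (ζ - w))))
      hm2.aemeasurable, ← lintegral_add_right _ hm2.lintegral_prod_right',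
      mul_comm, ← hvol, ← setLIntegral_const]
    exact setLIntegral_mono' measurableSet_ball fun ζ hζ =>
      enorm_le_add_lintegral_gradSize hU hUb ha hw (Metric.ball_subset_closedBall hζ)
  have h2 : (∫⁻ ζ in Ω, ‖a ζ‖ₑ) ≤ eW1Norm a p * Q := by
    refine (setLIntegral_ball_le_eLpNorm hp1 hmΩ).trans ?_
    rw [ENNReal.ofReal_one, one_pow, one_mul]
    gcongr
    rw [eW1Norm, add_assoc]
    exact le_self_add
  have h3 : (∫⁻ t in Set.Ioc (0 : ℝ) 1, ∫⁻ ζ in Ω, 2 * ENNReal.ofReal (G (w + t • (ζ - w)))) ≤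
      2 * (T * (Q * eW1Norm a p)) := by
    calc _ ≤ ∫⁻ t in Set.Ioc (0 : ℝ) 1,
          2 * (ENNReal.ofReal (t ^ (-(2 / p))) * (Q * eW1Norm a p)) := by
          refine setLIntegral_mono' measurableSet_Ioc fun t ht => ?_
          rw [lintegral_const_mul' _ _ (by simp)]
          gcongr
          refine (setLIntegral_comp_add_smul_sub_le hp1 hGm (gradSize_nonneg a) hw ht).trans ?_
          gcongr
          exact eLpNorm_gradSize_le hp1 a
      _ = _ := by
          rw [lintegral_const_mul' _ _ (by simp), lintegral_mul_const]
          exact ((measurable_id.pow_const _)).ennreal_ofReal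
  have h4 := h1.trans (add_le_add h2 h3)
  rw [mul_assoc, ← ENNReal.div_eq_inv_mul, ENNReal.le_div_iff_mul_le (Or.inl hpi0)
    (Or.inl ENNReal.coe_ne_top), mul_comm]
  refine h4.trans (le_of_eq ?_)
  ring

lemma setLIntegral_abs_sub_rpow_le {α r : ℝ} (hα : α < 1) (hr : 0 ≤ r) (c : ℝ) :
    ∫⁻ x in Set.Ioo (c - r) (c + r), ENNReal.ofReal (|x - c| ^ (-α)) ≤
      ENNReal.ofReal (2 * (r ^ (1 - α) / (1 - α))) := by
  have h0 : IntervalIntegrable (fun x : ℝ => |x| ^ (-α)) volume 0 r := by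
    refine (intervalIntegral.intervalIntegrable_rpow' (r := -α) (by linarith)).congr ?_
    intro x hx
    rw [Set.uIoc_of_le hr] at hx
    simp only [abs_of_pos hx.1]
  have h1 : IntervalIntegrable (fun x : ℝ => |x| ^ (-α)) volume (-r) 0 := by
    have := ((IntervalIntegrable.iff_comp_neg (by finiteness)).1 h0).symm
    simpa using this
  have hi : IntervalIntegrable (fun x : ℝ => |x - c| ^ (-α)) volume (c - r) (c + r) := by
    have h2 := (h1.trans h0).comp_sub_right c
    rwa [neg_add_eq_sub, add_comm r c] at h2
  have hle : c - r ≤ c + r := by linarith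
  have hval : ∫ x in (c - r)..(c + r), |x - c| ^ (-α) = 2 * (r ^ (1 - α) / (1 - α)) := by
    rw [intervalIntegral.integral_comp_sub_right (fun x => |x| ^ (-α)) c]
    have e : (∫ x in (c - r - c)..(c + r - c), |x| ^ (-α)) = ∫ x in (-r)..r, |x| ^ (-α) := by
      congr 1 <;> ring
    have e0 : (∫ x in (0 : ℝ)..r, |x| ^ (-α)) = r ^ (1 - α) / (1 - α) := by
      have : (∫ x in (0 : ℝ)..r, |x| ^ (-α)) = ∫ x in (0 : ℝ)..r, x ^ (-α) := by
        refine intervalIntegral.integral_congr fun x hx => ?_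
        rw [Set.uIcc_of_le hr] at hx
        simp only [abs_of_nonneg hx.1]
      rw [this, integral_rpow (Or.inl (by linarith)), Real.zero_rpow (by linarith), sub_zero,
        neg_add_eq_sub]
    have e1 : (∫ x in (-r)..0, |x| ^ (-α)) = ∫ x in (0 : ℝ)..r, |x| ^ (-α) := by
      have := intervalIntegral.integral_comp_neg (a := 0) (b := r) fun x : ℝ => |x| ^ (-α)
      simp only [abs_neg, neg_zero] at this
      exact this.symm
    rw [e, ← intervalIntegral.integral_add_adjacent_intervals h1 h0, e1, e0, two_mul]
  rw [← hval, intervalIntegral.integral_of_le hle]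
  rw [intervalIntegrable_iff_integrableOn_Ioc_of_le hle] at hi
  rw [ofReal_integral_eq_lintegral_ofReal hi
    (Filter.Eventually.of_forall fun x => Real.rpow_nonneg (abs_nonneg _) _)]
  exact lintegral_mono_set Set.Ioo_subset_Ioc_self

lemma ball_slice (x y : ℝ) :
    ((x : ℂ) + y * Complex.I) ∈ Metric.ball (0 : ℂ) 1 ↔
      x ∈ Set.Ioo (-√(1 - y ^ 2)) (√(1 - y ^ 2)) := by
  rw [mem_ball_zero_iff, Complex.norm_add_mul_I, Real.sqrt_lt' one_pos, Set.mem_Ioo, ← abs_lt,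
    Real.lt_sqrt (abs_nonneg _), sq_abs]
  constructor <;> intro h <;> linarith

lemma setLIntegral_ball_eq {f : ℂ → ENNReal} (hf : Measurable f) :
    ∫⁻ z in Metric.ball (0 : ℂ) 1, f z =
      ∫⁻ y : ℝ, ∫⁻ x in Set.Ioo (-√(1 - y ^ 2)) (√(1 - y ^ 2)), f (x + y * Complex.I) := by
  have hm := hf.indicator (measurableSet_ball (x := (0 : ℂ)) (ε := 1))
  rw [← lintegral_indicator measurableSet_ball,
    ← Complex.volume_preserving_equiv_real_prod.symm.lintegral_comp hm, Measure.volume_eq_prod,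
    lintegral_prod_symm' (fun q => (Metric.ball (0 : ℂ) 1).indicator f
      (Complex.measurableEquivRealProd.symm q))
      (hm.comp Complex.measurableEquivRealProd.symm.measurable)]
  refine lintegral_congr fun y => ?_
  rw [← lintegral_indicator measurableSet_Ioo]
  refine lintegral_congr fun x => ?_
  rw [Complex.measurableEquivRealProd_symm_apply, Complex.mk_eq_add_mul_I]
  by_cases h : x ∈ Set.Ioo (-√(1 - y ^ 2)) (√(1 - y ^ 2))
  · rw [Set.indicator_of_mem h, Set.indicator_of_mem ((ball_slice x y).2 h)]
  · rw [Set.indicator_of_notMem h, Set.indicator_of_notMem (mt (ball_slice x y).1 h)]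

lemma enorm_setIntegral_ball_le (f : ℂ → ℂ) :
    ‖∫ z in Metric.ball (0 : ℂ) 1, f z‖ₑ ≤
      ∫⁻ y : ℝ, ‖∫ x in Set.Ioo (-√(1 - y ^ 2)) (√(1 - y ^ 2)), f (x + y * Complex.I)‖ₑ := by
  by_cases hf : IntegrableOn f (Metric.ball (0 : ℂ) 1)
  swap
  · rw [integral_undef hf, enorm_zero]; exact zero_le
  rw [← integrable_indicator_iff measurableSet_ball] at hf
  rw [← integral_indicator measurableSet_ball,
    ← Complex.volume_preserving_equiv_real_prod.symm.integral_comp'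
      (g := (Metric.ball (0 : ℂ) 1).indicator f), Measure.volume_eq_prod]
  have hi := (Complex.volume_preserving_equiv_real_prod.symm.integrable_comp_emb
    Complex.measurableEquivRealProd.symm.measurableEmbedding).2 hf
  rw [Measure.volume_eq_prod] at hi
  rw [integral_prod_symm (fun q => (Metric.ball (0 : ℂ) 1).indicator f
    (Complex.measurableEquivRealProd.symm q)) hi]
  refine (enorm_integral_le_lintegral_enorm _).trans (le_of_eq (lintegral_congr fun y => ?_))
  rw [← integral_indicator measurableSet_Ioo]
  congr 2
  ext x
  rw [Complex.measurableEquivRealProd_symm_apply, Complex.mk_eq_add_mul_I]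
  by_cases h : x ∈ Set.Ioo (-√(1 - y ^ 2)) (√(1 - y ^ 2))
  · rw [Set.indicator_of_mem h, Set.indicator_of_mem ((ball_slice x y).2 h)]
  · rw [Set.indicator_of_notMem h, Set.indicator_of_notMem (mt (ball_slice x y).1 h)]

lemma norm_rpow_neg_add_le {α β : ℝ} (hα : 0 ≤ α) (hβ : 0 ≤ β) {u : ℂ} (hr : u.re ≠ 0)
    (hi : u.im ≠ 0) : ‖u‖ ^ (-(α + β)) ≤ |u.re| ^ (-α) * |u.im| ^ (-β) := by
  have hu : 0 < ‖u‖ := (abs_pos.2 hr).trans_le (Complex.abs_re_le_norm u)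
  rw [neg_add, Real.rpow_add hu]
  exact mul_le_mul
    (Real.rpow_le_rpow_of_nonpos (abs_pos.2 hr) (Complex.abs_re_le_norm u) (by linarith))
    (Real.rpow_le_rpow_of_nonpos (abs_pos.2 hi) (Complex.abs_im_le_norm u) (by linarith))
    (Real.rpow_nonneg hu.le _) (Real.rpow_nonneg (abs_nonneg _) _)

lemma exp_phase_eq (n x y : ℝ) (z₀ : ℂ) :
    Complex.exp (-Complex.I * (n : ℂ) * (((x + y * Complex.I) - z₀) ^ 2 +
      ((starRingEnd ℂ) ((x + y * Complex.I) - z₀)) ^ 2)) =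
    chirp (-(2 * n)) (y - z₀.im) * chirp (2 * n) (x - z₀.re) := by
  rw [chirp, chirp, ← Complex.exp_add]
  congr 1
  have h1 : (x + y * Complex.I : ℂ) - z₀ =
      ((x - z₀.re : ℝ) : ℂ) + ((y - z₀.im : ℝ) : ℂ) * Complex.I := by
    apply Complex.ext <;> simp
  rw [h1, map_add, map_mul, Complex.conj_ofReal, Complex.conj_ofReal, Complex.conj_I]
  push_cast
  linear_combination (-2 * Complex.I * n * ((y : ℂ) - z₀.im) ^ 2) * Complex.I_sq

/-- `enorm` form of the van der Corput estimate. -/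
lemma enorm_integral_chirp_mul_le {l c a b : ℝ} (hl : 0 < l) (hab : a ≤ b) {g g' : ℝ → ℂ}
    (hg : ∀ t ∈ Set.Icc a b, HasDerivAt g (g' t) t) (hg' : ContinuousOn g' (Set.Icc a b)) :
    ‖∫ t in Set.Ioo a b, chirp l (t - c) * g t‖ₑ ≤
      ENNReal.ofReal (4 / √l) * (‖g b‖ₑ + ∫⁻ t in Set.Ioo a b, ‖g' t‖ₑ) := by
  have h := norm_integral_chirp_mul_le (c := c) hl hab hg hg'
  rw [intervalIntegral.integral_of_le hab, intervalIntegral.integral_of_le hab,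
    integral_Ioc_eq_integral_Ioo, integral_Ioc_eq_integral_Ioo] at h
  have hi : IntegrableOn g' (Set.Ioo a b) :=
    (hg'.integrableOn_Icc).mono_set Set.Ioo_subset_Icc_self
  rw [← ofReal_norm, ← ofReal_norm, ← ofReal_integral_norm_eq_lintegral_enorm hi,
    ← ENNReal.ofReal_add (norm_nonneg _) (integral_nonneg fun _ => norm_nonneg _),
    ← ENNReal.ofReal_mul (by positivity)]
  exact ENNReal.ofReal_le_ofReal h

lemma setLIntegral_chord_rpow_le {c : ℝ} (hc : |c| ≤ 1) (y : ℝ) :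
    ∫⁻ x in Set.Ioo (-√(1 - y ^ 2)) (√(1 - y ^ 2)), ENNReal.ofReal (|x - c| ^ (-(4 / 5 : ℝ))) ≤
      ENNReal.ofReal 20 := by
  have hl : √(1 - y ^ 2) ≤ 1 := Real.sqrt_le_one.2 (by nlinarith [sq_nonneg y])
  have hc' := abs_le.1 hc
  have h0 := setLIntegral_abs_sub_rpow_le (α := 4 / 5) (r := 2) (by norm_num) zero_le_two c
  refine (lintegral_mono_set (Set.Ioo_subset_Ioo (by linarith) (by linarith))).trans
    (h0.trans (ENNReal.ofReal_le_ofReal ?_))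
  have h2 : (2 : ℝ) ^ (1 - 4 / 5 : ℝ) ≤ 2 ^ (1 : ℝ) :=
    Real.rpow_le_rpow_of_exponent_le one_le_two (by norm_num)
  rw [Real.rpow_one] at h2
  calc 2 * ((2 : ℝ) ^ (1 - 4 / 5 : ℝ) / (1 - 4 / 5)) = 10 * (2 : ℝ) ^ (1 - 4 / 5 : ℝ) := by ring
    _ ≤ 20 := by linarith

lemma sub_add_mul_I_re (z : ℂ) (x y : ℝ) : (z - (x + y * Complex.I)).re = z.re - x := by simp

lemma sub_add_mul_I_im (z : ℂ) (x y : ℝ) : (z - (x + y * Complex.I)).im = z.im - y := by simp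

/-- Absolute bound for the integral over a horizontal chord. -/
lemma enorm_chord_integral_le {a e : ℂ → ℂ} {S : ℝ}
    (he : ∀ w, ‖e w‖ ≤ 1) (hS : ∀ w ∈ Metric.closedBall (0 : ℂ) 1, ‖a w‖ ≤ S)
    {z : ℂ} (hz : z ∈ Metric.ball (0 : ℂ) 1) {y : ℝ} (hy : y ≠ z.im) :
    ‖∫ x in Set.Ioo (-√(1 - y ^ 2)) (√(1 - y ^ 2)),
        e (x + y * Complex.I) * a (x + y * Complex.I) / (z - (x + y * Complex.I))‖ₑ ≤
      ENNReal.ofReal (S * 20) * ENNReal.ofReal (|y - z.im| ^ (-(1 / 5 : ℝ))) := by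
  have hS0 : 0 ≤ S := (norm_nonneg _).trans (hS 0 (by simp))
  have hY : 0 ≤ |y - z.im| ^ (-(1 / 5 : ℝ)) := Real.rpow_nonneg (abs_nonneg _) _
  have hzre : |z.re| ≤ 1 :=
    (Complex.abs_re_le_norm z).trans (mem_ball_zero_iff.1 hz).le
  refine (enorm_integral_le_lintegral_enorm _).trans ?_
  have hb : (∫⁻ x in Set.Ioo (-√(1 - y ^ 2)) (√(1 - y ^ 2)),
        ‖e (x + y * Complex.I) * a (x + y * Complex.I) / (z - (x + y * Complex.I))‖ₑ) ≤
      ∫⁻ x in Set.Ioo (-√(1 - y ^ 2)) (√(1 - y ^ 2)),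
        ENNReal.ofReal (S * |y - z.im| ^ (-(1 / 5 : ℝ))) *
          ENNReal.ofReal (|x - z.re| ^ (-(4 / 5 : ℝ))) := by
    refine lintegral_mono_ae ((ae_restrict_iff' measurableSet_Ioo).2 ?_)
    filter_upwards [Measure.ae_ne volume z.re] with x hx hmem
    have hw := Metric.ball_subset_closedBall ((ball_slice x y).2 hmem)
    rw [← ofReal_norm, ← ENNReal.ofReal_mul (by positivity)]
    refine ENNReal.ofReal_le_ofReal ?_
    have hk := norm_rpow_neg_add_le (α := 4 / 5) (β := 1 / 5) (by norm_num) (by norm_num)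
      (u := z - (x + y * Complex.I))
      (by rw [sub_add_mul_I_re]; exact sub_ne_zero.2 hx.symm)
      (by rw [sub_add_mul_I_im]; exact sub_ne_zero.2 hy.symm)
    rw [sub_add_mul_I_re, sub_add_mul_I_im, abs_sub_comm z.re, abs_sub_comm z.im,
      show (-(4 / 5 + 1 / 5) : ℝ) = -1 by norm_num, Real.rpow_neg_one] at hk
    rw [norm_div, norm_mul, div_eq_mul_inv]
    calc ‖e (x + y * Complex.I)‖ * ‖a (x + y * Complex.I)‖ * ‖z - (x + y * Complex.I)‖⁻¹
        ≤ 1 * S * (|x - z.re| ^ (-(4 / 5) : ℝ) * |y - z.im| ^ (-(1 / 5) : ℝ)) := by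
          gcongr
          · exact he _
          · exact hS _ hw
      _ = _ := by ring
  refine hb.trans ?_
  rw [lintegral_const_mul' _ _ ENNReal.ofReal_ne_top]
  refine (mul_le_mul_right (setLIntegral_chord_rpow_le hzre y) _).trans (le_of_eq ?_)
  rw [← ENNReal.ofReal_mul (by positivity), ← ENNReal.ofReal_mul (by positivity)]
  congr 1; ring

/-- Oscillatory bound for the integral over a horizontal chord away from the pole. -/
lemma enorm_chord_integral_chirp_le {a : ℂ → ℂ} {U : Set ℂ} (hU : IsOpen U)
    (hUb : Metric.closedBall (0 : ℂ) 1 ⊆ U) (ha : ContDiffOn ℝ 1 a U) {S : ℝ}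
    (hS : ∀ w ∈ Metric.closedBall (0 : ℂ) 1, ‖a w‖ ≤ S)
    {z : ℂ} (hz : z ∈ Metric.ball (0 : ℂ) 1) {y δ : ℝ} (hy1 : y ^ 2 ≤ 1) (hδ : 0 < δ)
    (hy : δ ≤ |y - z.im|) {l : ℝ} (hl : 0 < l) (c : ℝ) :
    ‖∫ x in Set.Ioo (-√(1 - y ^ 2)) (√(1 - y ^ 2)),
        chirp l (x - c) * (a (x + y * Complex.I) / (z - (x + y * Complex.I)))‖ₑ ≤
      ENNReal.ofReal (4 / √l) * (ENNReal.ofReal (S * δ⁻¹) +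
        (ENNReal.ofReal δ⁻¹ * (∫⁻ x in Set.Ioo (-√(1 - y ^ 2)) (√(1 - y ^ 2)),
          ENNReal.ofReal (gradSize a (x + y * Complex.I))) +
        ENNReal.ofReal (S * 20 * δ ^ (-(6 / 5 : ℝ))))) := by
  have hS0 : 0 ≤ S := (norm_nonneg _).trans (hS 0 (by simp))
  have hzre : |z.re| ≤ 1 :=
    (Complex.abs_re_le_norm z).trans (mem_ball_zero_iff.1 hz).le
  have hyz : z.im - y ≠ 0 := fun h => by
    rw [show y - z.im = 0 by linarith, abs_zero] at hy; linarith
  set L := √(1 - y ^ 2) with hL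
  have hL0 : 0 ≤ L := Real.sqrt_nonneg _
  set γ : ℝ → ℂ := fun x => x + y * Complex.I with hγ
  have hγd : ∀ x, HasDerivAt γ 1 x := fun x => by
    simpa [hγ] using ((hasDerivAt_id x).ofReal_comp).add_const ((y : ℂ) * Complex.I)
  have hγm : ∀ x ∈ Set.Icc (-L) L, γ x ∈ Metric.closedBall (0 : ℂ) 1 := fun x hx => by
    rw [mem_closedBall_zero_iff, hγ, Complex.norm_add_mul_I, Real.sqrt_le_one]
    have := sq_le_sq' hx.1 hx.2
    rw [hL, Real.sq_sqrt (by linarith)] at this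
    linarith
  have hδn : ∀ x, δ ≤ ‖z - γ x‖ := fun x => by
    refine hy.trans ?_
    rw [abs_sub_comm, ← sub_add_mul_I_im z x y]
    exact Complex.abs_im_le_norm _
  have hne : ∀ x, z - γ x ≠ 0 := fun x => norm_pos_iff.1 (hδ.trans_le (hδn x))
  set g : ℝ → ℂ := fun x => a (γ x) / (z - γ x) with hg
  set g' : ℝ → ℂ := fun x => fderiv ℝ a (γ x) 1 / (z - γ x) + a (γ x) / (z - γ x) ^ 2 with hg'
  have hγc : Continuous γ := by fun_prop
  have hgd : ∀ x ∈ Set.Icc (-L) L, HasDerivAt g (g' x) x := by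
    intro x hx
    have h1 : HasDerivAt (fun t => a (γ t)) (fderiv ℝ a (γ x) 1) x :=
      ((ha.differentiableOn (by norm_num)).differentiableAt
        (hU.mem_nhds (hUb (hγm x hx)))).hasFDerivAt.comp_hasDerivAt x (hγd x)
    have h2 : HasDerivAt g _ x := h1.fun_div ((hγd x).const_sub z) (hne x)
    refine h2.congr_deriv ?_
    have := hne x
    simp only [hg']
    field_simp
    ring
  have hcf := ha.continuousOn_fderiv_of_isOpen hU le_rfl
  have hgc : ContinuousOn g' (Set.Icc (-L) L) := by
    have hmaps : Set.MapsTo γ (Set.Icc (-L) L) U := fun x hx => hUb (hγm x hx)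
    have h1 : ContinuousOn (fun x => fderiv ℝ a (γ x) 1) (Set.Icc (-L) L) :=
      (hcf.comp hγc.continuousOn hmaps).clm_apply continuousOn_const
    have h2 : ContinuousOn (fun x => a (γ x)) (Set.Icc (-L) L) :=
      ha.continuousOn.comp hγc.continuousOn hmaps
    exact (h1.div (by fun_prop) fun x _ => hne x).add
      (h2.div (by fun_prop) fun x _ => pow_ne_zero 2 (hne x))
  refine (enorm_integral_chirp_mul_le (c := c) hl (by linarith) hgd hgc).trans ?_
  have hinv : ∀ x, ‖z - γ x‖⁻¹ ≤ δ⁻¹ := fun x => inv_anti₀ hδ (hδn x)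
  gcongr
  · rw [← ofReal_norm]
    refine ENNReal.ofReal_le_ofReal ?_
    rw [hg, norm_div, div_eq_mul_inv]
    exact mul_le_mul (hS _ (hγm L ⟨by linarith, le_rfl⟩)) (hinv L) (by positivity) hS0
  · have hb : (∫⁻ x in Set.Ioo (-L) L, ‖g' x‖ₑ) ≤ ∫⁻ x in Set.Ioo (-L) L,
        (ENNReal.ofReal δ⁻¹ * ENNReal.ofReal (gradSize a (γ x)) +
          ENNReal.ofReal (S * δ ^ (-(6 / 5 : ℝ))) *
            ENNReal.ofReal (|x - z.re| ^ (-(4 / 5 : ℝ)))) := by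
      refine lintegral_mono_ae ((ae_restrict_iff' measurableSet_Ioo).2 ?_)
      filter_upwards [Measure.ae_ne volume z.re] with x hx hmem
      have hw := hγm x (Set.Ioo_subset_Icc_self hmem)
      have hG := gradSize_nonneg a (γ x)
      rw [← ofReal_norm, ← ENNReal.ofReal_mul (by positivity),
        ← ENNReal.ofReal_mul (by positivity), ← ENNReal.ofReal_add (by positivity) (by positivity)]
      refine ENNReal.ofReal_le_ofReal ((norm_add_le _ _).trans (add_le_add ?_ ?_))
      · rw [norm_div, div_eq_mul_inv, mul_comm]
        refine mul_le_mul (hinv x) ?_ (norm_nonneg _) (by positivity)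
        simpa using norm_fderiv_apply_le a (γ x) 1
      · have hk := norm_rpow_neg_add_le (α := 4 / 5) (β := 6 / 5) (by norm_num) (by norm_num)
          (u := z - γ x)
          (by rw [sub_add_mul_I_re]; exact sub_ne_zero.2 hx.symm)
          (by rw [sub_add_mul_I_im]; exact hyz)
        rw [sub_add_mul_I_re, sub_add_mul_I_im, abs_sub_comm z.re, abs_sub_comm z.im,
          show (-(4 / 5 + 6 / 5) : ℝ) = -(2 : ℕ) by norm_num, Real.rpow_neg (norm_nonneg _),
          Real.rpow_natCast] at hk
        have hk2 : |y - z.im| ^ (-(6 / 5 : ℝ)) ≤ δ ^ (-(6 / 5 : ℝ)) :=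
          Real.rpow_le_rpow_of_nonpos hδ hy (by norm_num)
        rw [norm_div, norm_pow, div_eq_mul_inv]
        calc ‖a (γ x)‖ * (‖z - γ x‖ ^ 2)⁻¹
            ≤ S * (|x - z.re| ^ (-(4 / 5) : ℝ) * δ ^ (-(6 / 5) : ℝ)) :=
              mul_le_mul (hS _ hw) (hk.trans (by gcongr)) (by positivity) hS0
          _ = _ := by ring
    have hm : Measurable fun x : ℝ => ENNReal.ofReal δ⁻¹ * ENNReal.ofReal (gradSize a (γ x)) :=
      (((measurable_gradSize a).comp hγc.measurable).ennreal_ofReal).const_mul _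
    refine hb.trans ?_
    rw [lintegral_add_left hm, lintegral_const_mul' _ _ ENNReal.ofReal_ne_top,
      lintegral_const_mul' _ _ ENNReal.ofReal_ne_top]
    gcongr
    refine (mul_le_mul_right (setLIntegral_chord_rpow_le hzre y) _).trans (le_of_eq ?_)
    rw [← ENNReal.ofReal_mul (by positivity)]
    congr 1; ring

lemma enorm_setIntegral_ball_phase_le {a : ℂ → ℂ} {U : Set ℂ} (hU : IsOpen U)
    (hUb : Metric.closedBall (0 : ℂ) 1 ⊆ U) (ha : ContDiffOn ℝ 1 a U) {S : ℝ}
    (hS : ∀ w ∈ Metric.closedBall (0 : ℂ) 1, ‖a w‖ ≤ S)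
    {z : ℂ} (hz : z ∈ Metric.ball (0 : ℂ) 1) (z₀ : ℂ) {n : ℝ} (hn : 1 < n) :
    ‖∫ w in Metric.ball (0 : ℂ) 1, Complex.exp (-Complex.I * (n : ℂ) *
        ((w - z₀) ^ 2 + ((starRingEnd ℂ) (w - z₀)) ^ 2)) * a w / (z - w)‖ₑ ≤
      ENNReal.ofReal (n ^ (-(1 : ℝ) / 5)) * (ENNReal.ofReal (218 * S) +
        4 * ∫⁻ w in Metric.ball (0 : ℂ) 1, ENNReal.ofReal (gradSize a w)) := by
  have hn0 : 0 < n := by linarith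
  have hS0 : 0 ≤ S := (norm_nonneg _).trans (hS 0 (by simp))
  set D := ∫⁻ w in Metric.ball (0 : ℂ) 1, ENNReal.ofReal (gradSize a w) with hD
  set ν : ℝ := n ^ (-(1 : ℝ) / 5) with hν
  set δ : ℝ := n ^ (-(1 : ℝ) / 4) with hδdef
  have hδ : 0 < δ := Real.rpow_pos_of_pos hn0 _
  have hν0 : 0 < ν := Real.rpow_pos_of_pos hn0 _
  set e : ℂ → ℂ := fun w => Complex.exp (-Complex.I * (n : ℂ) *
        ((w - z₀) ^ 2 + ((starRingEnd ℂ) (w - z₀)) ^ 2)) with he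
  have he_eq : ∀ x y : ℝ, e (x + y * Complex.I) =
      chirp (-(2 * n)) (y - z₀.im) * chirp (2 * n) (x - z₀.re) := fun x y => exp_phase_eq n x y z₀
  have he1 : ∀ w, ‖e w‖ ≤ 1 := fun w => by
    rw [← Complex.re_add_im w, he_eq, norm_mul, norm_chirp, norm_chirp, one_mul]
  set M : ENNReal := ENNReal.ofReal (4 / √(2 * n)) with hM
  set Gy : ℝ → ENNReal := fun y => ∫⁻ x in Set.Ioo (-√(1 - y ^ 2)) (√(1 - y ^ 2)),
    ENNReal.ofReal (gradSize a (x + y * Complex.I)) with hGy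
  set A : ℝ → ENNReal := fun y =>
    ENNReal.ofReal (S * 20) * ENNReal.ofReal (|y - z.im| ^ (-(1 / 5 : ℝ))) with hA
  set B : ℝ → ENNReal := fun y => M * (ENNReal.ofReal (S * δ⁻¹) +
    (ENNReal.ofReal δ⁻¹ * Gy y + ENNReal.ofReal (S * 20 * δ ^ (-(6 / 5 : ℝ))))) with hB
  set J : Set ℝ := Set.Ioo (z.im - δ) (z.im + δ) with hJ
  have hAm : Measurable (J.indicator A) := by
    refine Measurable.indicator ?_ measurableSet_Ioo
    exact ((((measurable_id.sub_const _).norm).pow_const _).ennreal_ofReal).const_mul _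
  have hslice : ∀ y : ℝ, y ≠ z.im →
      ‖∫ x in Set.Ioo (-√(1 - y ^ 2)) (√(1 - y ^ 2)),
        e (x + y * Complex.I) * a (x + y * Complex.I) / (z - (x + y * Complex.I))‖ₑ ≤
      (Set.Ioo (-1 : ℝ) 1).indicator (fun y => J.indicator A y + B y) y := by
    intro y hy
    by_cases hy1 : y ∈ Set.Ioo (-1 : ℝ) 1
    · rw [Set.indicator_of_mem hy1]
      by_cases hyJ : y ∈ J
      · rw [Set.indicator_of_mem hyJ]
        exact (enorm_chord_integral_le he1 hS hz hy).trans le_self_add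
      · rw [Set.indicator_of_notMem hyJ, zero_add]
        have hyδ : δ ≤ |y - z.im| := by
          by_contra! h
          rw [abs_lt] at h
          exact hyJ ⟨by linarith, by linarith⟩
        have hmain := enorm_chord_integral_chirp_le hU hUb ha hS hz (y := y) (by
          nlinarith [hy1.1, hy1.2]) hδ hyδ (by positivity : 0 < 2 * n) z₀.re
        simp only [he_eq, mul_assoc, mul_div_assoc]
        rw [integral_const_mul, enorm_mul, ← ofReal_norm (chirp _ _), norm_chirp,
          ENNReal.ofReal_one, one_mul]
        exact hmain
    · rw [Set.indicator_of_notMem hy1]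
      have h0 : √(1 - y ^ 2) = 0 := by
        apply Real.sqrt_eq_zero_of_nonpos
        by_contra! h
        exact hy1 (abs_lt.1 (by rw [← sq_lt_one_iff_abs_lt_one]; linarith))
      simp [h0]
  have hGD : ∫⁻ y in Set.Ioo (-1 : ℝ) 1, Gy y ≤ D := by
    rw [hD, setLIntegral_ball_eq (measurable_gradSize a).ennreal_ofReal]
    exact setLIntegral_le_lintegral _ _
  have hvol : (volume : Measure ℝ) (Set.Ioo (-1 : ℝ) 1) = 2 := by
    rw [Real.volume_Ioo]; norm_num
  have hAint : ∫⁻ y, J.indicator A y ≤ ENNReal.ofReal (50 * S * ν) := by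
    rw [lintegral_indicator measurableSet_Ioo, lintegral_const_mul' _ _ ENNReal.ofReal_ne_top]
    refine (mul_le_mul_right (setLIntegral_abs_sub_rpow_le (α := 1 / 5) (by norm_num) hδ.le z.im)
      _).trans (le_of_eq ?_)
    have : δ ^ (1 - 1 / 5 : ℝ) = ν := by
      rw [hδdef, hν, ← Real.rpow_mul hn0.le]; norm_num
    rw [← ENNReal.ofReal_mul (by positivity), this]
    congr 1; ring
  have hBint : ∫⁻ y in Set.Ioo (-1 : ℝ) 1, B y ≤
      M * (ENNReal.ofReal (S * δ⁻¹) * 2 + (ENNReal.ofReal δ⁻¹ * D +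
        ENNReal.ofReal (S * 20 * δ ^ (-(6 / 5 : ℝ))) * 2)) := by
    rw [lintegral_const_mul' _ _ ENNReal.ofReal_ne_top, lintegral_add_left measurable_const,
      lintegral_add_right _ measurable_const, lintegral_const_mul' _ _ ENNReal.ofReal_ne_top,
      setLIntegral_const, setLIntegral_const, hvol]
    gcongr
  have hM1 : 4 / √(2 * n) ≤ 4 * n ^ (-(1 : ℝ) / 2) := by
    rw [neg_div, Real.rpow_neg hn0.le, ← Real.sqrt_eq_rpow, ← div_eq_mul_inv]
    gcongr
    linarith
  have hδν : 4 / √(2 * n) * δ⁻¹ ≤ 4 * ν := by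
    refine (mul_le_mul_of_nonneg_right hM1 (by positivity)).trans ?_
    rw [mul_assoc, hδdef, ← Real.rpow_neg hn0.le, ← Real.rpow_add hn0]
    exact mul_le_mul_of_nonneg_left
      (Real.rpow_le_rpow_of_exponent_le hn.le (by norm_num)) (by norm_num)
  have hδν' : 4 / √(2 * n) * δ ^ (-(6 / 5 : ℝ)) ≤ 4 * ν := by
    refine (mul_le_mul_of_nonneg_right hM1 (by positivity)).trans (le_of_eq ?_)
    rw [mul_assoc, hδdef, ← Real.rpow_mul hn0.le, ← Real.rpow_add hn0]
    norm_num [hν]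
  calc _ ≤ ∫⁻ y, (Set.Ioo (-1 : ℝ) 1).indicator (fun y => J.indicator A y + B y) y := by
        refine (enorm_setIntegral_ball_le _).trans (lintegral_mono_ae ?_)
        filter_upwards [Measure.ae_ne volume z.im] with y hy using hslice y hy
    _ = (∫⁻ y in Set.Ioo (-1 : ℝ) 1, J.indicator A y) + ∫⁻ y in Set.Ioo (-1 : ℝ) 1, B y := by
        rw [lintegral_indicator measurableSet_Ioo, lintegral_add_left hAm]
    _ ≤ ENNReal.ofReal (50 * S * ν) + M * (ENNReal.ofReal (S * δ⁻¹) * 2 +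
          (ENNReal.ofReal δ⁻¹ * D + ENNReal.ofReal (S * 20 * δ ^ (-(6 / 5 : ℝ))) * 2)) :=
        add_le_add ((setLIntegral_le_lintegral _ _).trans hAint) hBint
    _ = ENNReal.ofReal (50 * S * ν) + (ENNReal.ofReal (S * 2 * (4 / √(2 * n) * δ⁻¹)) +
          (ENNReal.ofReal (4 / √(2 * n) * δ⁻¹) * D +
          ENNReal.ofReal (S * 40 * (4 / √(2 * n) * δ ^ (-(6 / 5 : ℝ)))))) := by
        have e1 : M * (ENNReal.ofReal (S * δ⁻¹) * 2) =
            ENNReal.ofReal (S * 2 * (4 / √(2 * n) * δ⁻¹)) := by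
          rw [hM, ← ENNReal.ofReal_ofNat 2, ← ENNReal.ofReal_mul (by positivity),
            ← ENNReal.ofReal_mul (by positivity)]
          congr 1; ring
        have e2 : M * ENNReal.ofReal δ⁻¹ = ENNReal.ofReal (4 / √(2 * n) * δ⁻¹) :=
          (ENNReal.ofReal_mul (by positivity)).symm
        have e3 : M * (ENNReal.ofReal (S * 20 * δ ^ (-(6 / 5 : ℝ))) * 2) =
            ENNReal.ofReal (S * 40 * (4 / √(2 * n) * δ ^ (-(6 / 5 : ℝ)))) := by
          rw [hM, ← ENNReal.ofReal_ofNat 2, ← ENNReal.ofReal_mul (by positivity),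
            ← ENNReal.ofReal_mul (by positivity)]
          congr 1; ring
        rw [mul_add, mul_add, e1, ← mul_assoc M, e2, e3]
    _ ≤ ENNReal.ofReal (50 * S * ν) + (ENNReal.ofReal (S * 2 * (4 * ν)) +
          (ENNReal.ofReal (4 * ν) * D + ENNReal.ofReal (S * 40 * (4 * ν)))) := by
        gcongr
    _ = ENNReal.ofReal ν * (ENNReal.ofReal (218 * S) + 4 * D) := by
        have e1 : ENNReal.ofReal ν * ENNReal.ofReal (218 * S) = ENNReal.ofReal (50 * S * ν) +
            (ENNReal.ofReal (S * 2 * (4 * ν)) + ENNReal.ofReal (S * 40 * (4 * ν))) := by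
          rw [← ENNReal.ofReal_mul hν0.le, ← ENNReal.ofReal_add (by positivity) (by positivity),
            ← ENNReal.ofReal_add (by positivity) (by positivity)]
          congr 1; ring
        rw [mul_add, e1, ENNReal.ofReal_mul zero_le_four, ENNReal.ofReal_ofNat]
        ring

/-- For `2 < p < ∞` there is `C_p < ∞` such that for all `n > 1`, `z₀` in the closed unit
disc and `a` which is `C¹` near the closed unit disc,
`‖𝒞(e^{-inR(·,z₀)} a)‖_{L^∞(Ω)} ≤ C_p n^{-1/5} ‖a‖_{W^{1,p}(Ω)}`. -/
theorem stmt_11 (p : ℝ) (hp : 2 < p) :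
    ∃ C : ℝ, 0 ≤ C ∧ ∀ n : ℝ, 1 < n → ∀ z₀ ∈ Metric.closedBall (0 : ℂ) 1,
      ∀ a : ℂ → ℂ,
        (∃ U : Set ℂ, IsOpen U ∧ Metric.closedBall (0 : ℂ) 1 ⊆ U ∧ ContDiffOn ℝ 1 a U) →
        (eLpNorm (fun z : ℂ => (1 / (Real.pi : ℂ)) *
            ∫ w in Metric.ball (0 : ℂ) 1,
              Complex.exp (-Complex.I * (n : ℂ) *
                ((w - z₀) ^ 2 + ((starRingEnd ℂ) (w - z₀)) ^ 2)) * a w / (z - w))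
          ⊤ (volume.restrict (Metric.ball (0 : ℂ) 1))).toReal ≤
        C * n ^ (-(1 : ℝ) / 5) * W1Norm a p := by
  have hp1 : 1 ≤ p := by linarith
  obtain ⟨C, hC, hmor⟩ := exists_enorm_le_mul_eW1Norm hp
  have hθ : 0 ≤ 1 - 1 / p := by rw [sub_nonneg, div_le_one (by linarith)]; exact hp1
  set Q : ENNReal := (NNReal.pi : ENNReal) ^ (1 - 1 / p) with hQ
  have hQtop : Q ≠ ⊤ := ENNReal.rpow_ne_top_of_nonneg hθ ENNReal.coe_ne_top
  have hK : 218 * C + 4 * Q ≠ ⊤ := by finiteness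
  refine ⟨(218 * C + 4 * Q).toReal, ENNReal.toReal_nonneg, ?_⟩
  rintro n hn z₀ - a ⟨U, hU, hUb, ha⟩
  have hW0 : 0 ≤ W1Norm a p := by unfold W1Norm; positivity
  have hν0 : 0 ≤ n ^ (-(1 : ℝ) / 5) := Real.rpow_nonneg (by linarith) _
  have hW := ofReal_W1Norm hU hUb ha p
  have hS : ∀ w ∈ Metric.closedBall (0 : ℂ) 1, ‖a w‖ ≤ C.toReal * W1Norm a p := fun w hw => by
    have h := hmor a U hU hUb ha w hw
    rw [← hW, ← ENNReal.ofReal_toReal hC, ← ENNReal.ofReal_mul ENNReal.toReal_nonneg,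
      ← ofReal_norm] at h
    exact (ENNReal.ofReal_le_ofReal_iff (by positivity)).1 h
  have hD : ∫⁻ w in Metric.ball (0 : ℂ) 1, ENNReal.ofReal (gradSize a w) ≤ eW1Norm a p * Q := by
    have h := setLIntegral_ball_le_eLpNorm hp1 (c := 0) (t := 1)
      (measurable_gradSize a).aestronglyMeasurable
    simp only [← ofReal_norm, Real.norm_of_nonneg (gradSize_nonneg a _)] at h
    rw [ENNReal.ofReal_one, one_pow, one_mul] at h
    exact h.trans (mul_le_mul_left (eLpNorm_gradSize_le hp1 a) _)
  refine ENNReal.toReal_le_of_le_ofReal (by positivity) ?_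
  rw [eLpNorm_exponent_top]
  refine eLpNormEssSup_le_of_ae_bound
    ((ae_restrict_iff' measurableSet_ball).2 (Filter.Eventually.of_forall fun z hz => ?_))
  have hmain : ‖∫ w in Metric.ball (0 : ℂ) 1, Complex.exp (-Complex.I * (n : ℂ) *
        ((w - z₀) ^ 2 + ((starRingEnd ℂ) (w - z₀)) ^ 2)) * a w / (z - w)‖ ≤
      (218 * C + 4 * Q).toReal * n ^ (-(1 : ℝ) / 5) * W1Norm a p := by
    rw [← ENNReal.ofReal_le_ofReal_iff (by positivity), ofReal_norm,
      ENNReal.ofReal_mul (by positivity), ENNReal.ofReal_mul ENNReal.toReal_nonneg,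
      ENNReal.ofReal_toReal hK]
    refine (enorm_setIntegral_ball_phase_le hU hUb ha hS hz z₀ hn).trans ?_
    rw [ENNReal.ofReal_mul (by norm_num), ENNReal.ofReal_mul ENNReal.toReal_nonneg,
      ENNReal.ofReal_toReal hC, ENNReal.ofReal_ofNat]
    calc _ ≤ ENNReal.ofReal (n ^ (-(1 : ℝ) / 5)) *
          (218 * (C * ENNReal.ofReal (W1Norm a p)) + 4 * (ENNReal.ofReal (W1Norm a p) * Q)) := by
          rw [hW]; gcongr
      _ = _ := by ring
  rw [norm_mul]
  refine (mul_le_mul_of_nonneg_right ?_ (norm_nonneg _)).trans ((one_mul _).trans_le hmain)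
  rw [norm_div, norm_one, Complex.norm_real, Real.norm_of_nonneg Real.pi_pos.le,
    div_le_one Real.pi_pos]
  linarith [Real.pi_gt_three]
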